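/- Fix ℏ > 0 and an integer N ≥ 1. For all x, p ∈ ℝ, σ_{P_{<N}}^ℏ(x,p) = 2 e^{−(p²+x²)/ℏ} Σ_{j=0}^{N−1} (−1)^j L_j(2(p²+x²)/ℏ), where L_j = L_j^{(0)} is the j-th Laguerre polynomial. -/

import Mathlib

open MeasureTheory Filter

/-- Physicists' Hermite polynomial `h_k(y) = (-1)^k e^{y^2} (d/dy)^k e^{-y^2}`. -/
noncomputable def hermiteH (k : ℕ) (y : ℝ) : ℝ :=
  (-1)^k * Real.exp (y^2) * iteratedDeriv k (fun t => Real.exp (-t^2)) y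

/-- Hermite function `ψ_k^ℏ`. -/
noncomputable def psiH (hbar : ℝ) (k : ℕ) (x : ℝ) : ℝ :=
  (Real.sqrt (Real.sqrt Real.pi * 2^k * (Nat.factorial k) * Real.sqrt hbar))⁻¹ *
    Real.exp (-x^2 / (2*hbar)) * hermiteH k (x / Real.sqrt hbar)

/-- Kernel of the spectral projection `P_{<N}`. -/
noncomputable def KerK (hbar : ℝ) (N : ℕ) (u v : ℝ) : ℝ :=
  ∑ k ∈ Finset.range N, psiH hbar k u * psiH hbar k v

/-- Kernel of the Zeno Hamiltonian `H_N = P_{<N} p̂ P_{<N}`. -/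
noncomputable def KerQ (hbar : ℝ) (N : ℕ) (u v : ℝ) : ℂ :=
  Complex.I * (Real.sqrt (hbar/2) : ℂ) *
    ∑ j ∈ Finset.range (N-1), ((Real.sqrt ((j:ℝ)+1) : ℝ) : ℂ) *
      ((psiH hbar (j+1) u * psiH hbar j v - psiH hbar j u * psiH hbar (j+1) v : ℝ) : ℂ)

/-- Weyl symbol of `P_{<N}`. -/
noncomputable def sigmaP (hbar : ℝ) (N : ℕ) (x p : ℝ) : ℂ :=
  ∫ y : ℝ, ((hbar * KerK hbar N (x - hbar*y/2) (x + hbar*y/2) : ℝ) : ℂ) *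
    Complex.exp (Complex.I * (p:ℂ) * (y:ℂ))

/-- Weyl symbol of `H_N`. -/
noncomputable def sigmaH (hbar : ℝ) (N : ℕ) (x p : ℝ) : ℂ :=
  ∫ y : ℝ, (hbar : ℂ) * KerQ hbar N (x - hbar*y/2) (x + hbar*y/2) *
    Complex.exp (Complex.I * (p:ℂ) * (y:ℂ))

/-- Associated Laguerre polynomial
`L_k^{(j)}(y) = Σ_{m=0}^k ((k+j)!/((k-m)!(j+m)!m!)) (-y)^m`. -/
noncomputable def laguerreL (j k : ℕ) (y : ℝ) : ℝ :=
  ∑ m ∈ Finset.range (k+1),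
    ((Nat.factorial (k+j) : ℝ) /
      ((Nat.factorial (k-m) : ℝ) * (Nat.factorial (j+m) : ℝ) * (Nat.factorial m : ℝ))) * (-y)^m

open Polynomial in
/-- Hermite polynomials by recursion. -/
noncomputable def hermPoly : ℕ → Polynomial ℂ
  | 0 => 1
  | n + 1 => 2 * X * hermPoly n - derivative (hermPoly n)

open Polynomial in
theorem hermPoly_deriv (n : ℕ) :
    derivative (hermPoly (n + 1)) = 2 * ((n : Polynomial ℂ) + 1) * hermPoly n := by
  induction n with
  | zero => simp [hermPoly]
  | succ n ih =>
    have h : derivative (hermPoly (n + 1 + 1)) =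
        2 * hermPoly (n + 1) + 2 * X * derivative (hermPoly (n + 1))
          - derivative (derivative (hermPoly (n + 1))) := by
      conv_lhs => rw [hermPoly]
      simp
    rw [h, ih]
    have h2 : derivative (2 * ((n : Polynomial ℂ) + 1) * hermPoly n) =
        2 * ((n : Polynomial ℂ) + 1) * derivative (hermPoly n) := by
      simp
    rw [h2]
    have h3 : hermPoly (n + 1) = 2 * X * hermPoly n - derivative (hermPoly n) := rfl
    rw [h3]; push_cast; ring

theorem hermite_iter (k : ℕ) :
    ∀ y : ℝ, ((iteratedDeriv k (fun t : ℝ => Real.exp (-t^2)) y : ℝ) : ℂ) =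
      (-1)^k * (hermPoly k).eval (y:ℂ) * (Real.exp (-y^2) : ℂ) := by
  induction k with
  | zero => intro y; simp [hermPoly]
  | succ k ih =>
    intro y
    have hd : ContDiff ℝ ⊤ (fun t : ℝ => Real.exp (-t^2)) := by fun_prop
    have hdiff : DifferentiableAt ℝ (iteratedDeriv k (fun t : ℝ => Real.exp (-t^2))) y :=
      (hd.differentiable_iteratedDeriv k (by exact_mod_cast WithTop.coe_lt_top _)) y
    have h1 := hdiff.hasDerivAt.ofReal_comp
    rw [← iteratedDeriv_succ] at h1
    have h2 : HasDerivAt (fun z : ℝ => (-1)^k * (hermPoly k).eval (z:ℂ) * (Real.exp (-z^2) : ℂ))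
        ((-1)^k * (hermPoly k).derivative.eval (y:ℂ) * (Real.exp (-y^2) : ℂ)
          + (-1)^k * (hermPoly k).eval (y:ℂ) * ((Real.exp (-y^2) * (-(2*y)) : ℝ) : ℂ)) y := by
      apply HasDerivAt.mul
      · exact (((hermPoly k).hasDerivAt (y:ℂ)).comp_ofReal).const_mul _
      · apply HasDerivAt.ofReal_comp
        have := ((hasDerivAt_pow 2 y).neg).exp
        simpa using this
    have h3 : (fun z : ℝ => ((iteratedDeriv k (fun t : ℝ => Real.exp (-t^2)) z : ℝ) : ℂ)) =
      (fun z : ℝ => (-1)^k * (hermPoly k).eval (z:ℂ) * (Real.exp (-z^2) : ℂ)) := funext ih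
    rw [h3] at h1
    rw [h1.unique h2]
    simp only [hermPoly, Polynomial.eval_sub, Polynomial.eval_mul, Polynomial.eval_X,
      Polynomial.eval_ofNat]
    push_cast
    ring

theorem hermiteH_eq (k : ℕ) (y : ℝ) : (hermiteH k y : ℂ) = (hermPoly k).eval (y:ℂ) := by
  unfold hermiteH
  push_cast [hermite_iter]
  have : Complex.exp ((y:ℂ)^2) * Complex.exp (-(y:ℂ)^2) = 1 := by
    rw [← Complex.exp_add]; simp
  have h2 : ((-1:ℂ)^k) * (-1)^k = 1 := by rw [← mul_pow]; simp
  calc _ = ((-1:ℂ)^k * (-1)^k) * (Complex.exp ((y:ℂ)^2) * Complex.exp (-(y:ℂ)^2))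
        * (hermPoly k).eval (y:ℂ) := by ring
    _ = _ := by rw [this, h2]; ring

section alg
open Polynomial

/-- Operator `a - 2 d/db`. -/
noncomputable def opT (a : ℂ) : Module.End ℂ (Polynomial ℂ) :=
  a • 1 + (-2 : ℂ) • derivative

theorem alg_rec (Λ : Polynomial ℂ →ₗ[ℂ] ℂ) (q x : ℂ)
    (hΛ : ∀ f, Λ (derivative f) = Λ (2 * (X - C q) * f)) (m n : ℕ) :
    Λ ((hermPoly m).comp (C x - X) * (hermPoly n).comp (C x + X)) =
      Λ 1 * ((opT (2 * (x - q)) ^ m) (X ^ n)).eval (2 * (x + q)) := by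
  have hC2 : (C (2:ℂ) : Polynomial ℂ) = 2 := rfl
  induction m generalizing n with
  | zero =>
    simp only [hermPoly, one_comp, one_mul, pow_zero, Module.End.one_apply, eval_pow, eval_X]
    induction n with
    | zero => simp [hermPoly]
    | succ n ih =>
      rw [pow_succ, ← mul_assoc, ← ih]
      have e : (hermPoly (n+1)).comp (C x + X) =
          (2 * (x + q)) • (hermPoly n).comp (C x + X)
          + (2 * (X - C q) * (hermPoly n).comp (C x + X)
            - derivative ((hermPoly n).comp (C x + X))) := by
        rw [derivative_comp]
        simp [hermPoly, smul_eq_C_mul, hC2]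
        ring
      rw [e, map_add, map_sub, hΛ, sub_self, map_smul, smul_eq_mul]
      ring
  | succ m ih =>
    have e : (hermPoly (m+1)).comp (C x - X) * (hermPoly n).comp (C x + X) =
        (2 * (x - q)) • ((hermPoly m).comp (C x - X) * (hermPoly n).comp (C x + X))
        - (hermPoly m).comp (C x - X) * derivative ((hermPoly n).comp (C x + X))
        + (derivative ((hermPoly m).comp (C x - X) * (hermPoly n).comp (C x + X))
          - 2 * (X - C q) * ((hermPoly m).comp (C x - X) * (hermPoly n).comp (C x + X))) := by
      rw [derivative_mul, derivative_comp, derivative_comp]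
      simp [hermPoly, smul_eq_C_mul, hC2]
      ring
    rw [e, map_add, map_sub, map_sub, hΛ, sub_self, map_smul, smul_eq_mul, ih, pow_succ,
      Module.End.mul_apply]
    have e2 : opT (2 * (x - q)) (X ^ n) =
        (2 * (x - q)) • X ^ n + (-2 : ℂ) • derivative (X ^ n : Polynomial ℂ) := rfl
    rw [e2, map_add, map_smul, map_smul, eval_add, eval_smul, eval_smul]
    cases n with
    | zero => simp [hermPoly]; ring
    | succ n =>
      have e3 : (hermPoly m).comp (C x - X) * derivative ((hermPoly (n+1)).comp (C x + X)) =
          (2 * ((n:ℂ) + 1)) • ((hermPoly m).comp (C x - X) * (hermPoly n).comp (C x + X)) := by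
        rw [derivative_comp, hermPoly_deriv]
        simp [smul_eq_C_mul, hC2]
        ring
      have e4 : derivative (X ^ (n+1) : Polynomial ℂ) = ((n:ℂ) + 1) • X ^ n := by
        simp [smul_eq_C_mul]
      rw [e3, e4, map_smul, map_smul, ih, eval_smul]
      simp only [smul_eq_mul]
      ring

theorem opT_pow (a b : ℂ) (k : ℕ) :
    ((opT a ^ k) (X ^ k)).eval b =
      ∑ m ∈ Finset.range (k+1), (k.choose m : ℂ) * a ^ m * (-2) ^ (k - m) *
        ((k.descFactorial (k-m) : ℂ) * b ^ m) := by
  have hc : Commute (a • (1 : Module.End ℂ (Polynomial ℂ))) ((-2 : ℂ) • derivative) :=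
    ((Commute.one_left _).smul_left a)
  unfold opT
  rw [hc.add_pow, LinearMap.sum_apply, eval_finsetSum]
  refine Finset.sum_congr rfl fun m hm => ?_
  have hm' : m ≤ k := by simpa [Nat.lt_succ_iff] using hm
  have : ((derivative : Module.End ℂ (Polynomial ℂ)) ^ (k-m)) (X^k) =
      (k.descFactorial (k-m) : Polynomial ℂ) * X ^ m := by
    rw [Module.End.pow_apply]
    have := iterate_derivative_X_pow_eq_natCast_mul (R := ℂ) k (k-m)
    rw [this, Nat.sub_sub_self hm']
  rw [_root_.smul_pow, _root_.smul_pow, one_pow, ← Nat.cast_comm (α := Module.End ℂ (Polynomial ℂ)),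
    Module.End.mul_apply, Module.End.mul_apply]
  rw [LinearMap.smul_apply, LinearMap.smul_apply, this]
  simp [Module.End.natCast_apply]
  ring

end alg

theorem alg_lag (x p : ℝ) (k : ℕ) :
    ((opT (2 * ((x:ℂ) - p * Complex.I)) ^ k) (Polynomial.X ^ k)).eval
        (2 * ((x:ℂ) + p * Complex.I)) =
      (2:ℂ)^k * (k.factorial : ℂ) * (((-1:ℝ)^k * laguerreL 0 k (2*(p^2+x^2)) : ℝ) : ℂ) := by
  rw [opT_pow]
  unfold laguerreL
  push_cast
  rw [Finset.mul_sum, Finset.mul_sum]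
  refine Finset.sum_congr rfl fun m hm => ?_
  obtain ⟨j, rfl⟩ : ∃ j, k = m + j :=
    Nat.exists_eq_add_of_le (by simpa [Nat.lt_succ_iff] using hm)
  have hab : (2 * ((x:ℂ) - p * Complex.I)) ^ m * (2 * ((x:ℂ) + p * Complex.I)) ^ m =
      (-2)^m * (-(2 * ((p:ℂ)^2 + (x:ℂ)^2)))^m := by
    rw [← mul_pow, ← mul_pow]
    congr 1
    linear_combination (-4) * (p:ℂ)^2 * Complex.I_sq
  have h1 : ((m+j).choose m : ℂ) = ((m+j).factorial : ℂ) / (m.factorial * j.factorial) := by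
    rw [Nat.cast_choose ℂ (Nat.le_add_right m j)]; simp
  have h2 : ((m+j).descFactorial j : ℂ) = ((m+j).factorial : ℂ) / m.factorial := by
    rw [eq_div_iff (by exact_mod_cast Nat.factorial_ne_zero m)]
    have := Nat.factorial_mul_descFactorial (Nat.le_add_left j m)
    rw [Nat.add_sub_cancel] at this
    exact_mod_cast (mul_comm _ _).trans this
  have hm0 : (m.factorial : ℂ) ≠ 0 := by exact_mod_cast Nat.factorial_ne_zero m
  have hj0 : (j.factorial : ℂ) ≠ 0 := by exact_mod_cast Nat.factorial_ne_zero j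
  simp only [Nat.add_sub_cancel_left, Nat.add_zero, Nat.zero_add]
  rw [h1, h2]
  calc _ = ((2 * ((x:ℂ) - p * Complex.I)) ^ m * (2 * ((x:ℂ) + p * Complex.I)) ^ m)
        * ((((m+j).factorial : ℂ) / (m.factorial * j.factorial)) * (-2)^j *
          (((m+j).factorial : ℂ) / m.factorial)) := by ring
    _ = _ := by
      rw [hab, show (-2:ℂ)^m = (-1)^m * 2^m by rw [← mul_pow]; norm_num,
        show (-2:ℂ)^j = (-1)^j * 2^j by rw [← mul_pow]; norm_num]
      field_simp
      ring

theorem gauss_norm (p s : ℝ) : ‖Complex.exp (-(s:ℂ)^2 + 2 * (p * Complex.I) * s)‖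
    = Real.exp (-s^2) := by
  rw [Complex.norm_exp]
  congr 1
  simp [pow_two]

theorem poly_gauss_integrable (p : ℝ) (f : Polynomial ℂ) :
    Integrable (fun s : ℝ => f.eval (s:ℂ) * Complex.exp (-(s:ℂ)^2 + 2 * (p * Complex.I) * s)) := by
  induction f using Polynomial.induction_on' with
  | add f g hf hg =>
    simp only [Polynomial.eval_add, add_mul]
    exact hf.add hg
  | monomial n a =>
    have h := integrable_rpow_mul_exp_neg_mul_sq (b := 1) one_pos (s := n)
      (by have : (0:ℝ) ≤ n := Nat.cast_nonneg n
          linarith)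
    have h2 := h.norm.const_mul ‖a‖
    refine h2.mono' (by fun_prop) (Eventually.of_forall fun s => ?_)
    rw [norm_mul, gauss_norm]
    simp [mul_assoc]

/-- The Gaussian functional on polynomials. -/
noncomputable def gaussFun (p : ℝ) : Polynomial ℂ →ₗ[ℂ] ℂ where
  toFun f := ∫ s : ℝ, f.eval (s:ℂ) * Complex.exp (-(s:ℂ)^2 + 2 * (p * Complex.I) * s)
  map_add' f g := by
    simp only [Polynomial.eval_add, add_mul]
    exact integral_add (poly_gauss_integrable p f) (poly_gauss_integrable p g)
  map_smul' c f := by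
    simp only [Polynomial.eval_smul, smul_eq_mul, mul_assoc, RingHom.id_apply]
    exact integral_const_mul _ _

open Polynomial in
theorem gaussFun_parts (p : ℝ) (f : Polynomial ℂ) :
    gaussFun p (derivative f) = gaussFun p (2 * (X - C ((p:ℂ) * Complex.I)) * f) := by
  rw [← sub_eq_zero, ← map_sub]
  refine integral_eq_zero_of_hasDerivAt_of_integrable (fun s => ?_)
    (poly_gauss_integrable p _) (poly_gauss_integrable p f)
  have h1 := ((f.hasDerivAt (s:ℂ)).mul
    ((((hasDerivAt_pow 2 (s:ℂ)).neg).add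
      ((hasDerivAt_id (s:ℂ)).const_mul (2 * ((p:ℂ) * Complex.I)))).cexp)).comp_ofReal
  refine HasDerivAt.congr_deriv h1 ?_
  simp
  ring

theorem gaussFun_one (p : ℝ) :
    gaussFun p 1 = ((Real.sqrt Real.pi * Real.exp (-p^2) : ℝ) : ℂ) := by
  have h := integral_cexp_quadratic (b := -1) (by simp) (2 * (p * Complex.I)) 0
  have : gaussFun p 1 = ∫ x : ℝ, Complex.exp (-1 * (x:ℂ)^2 + 2 * (p * Complex.I) * x + 0) := by
    simp [gaussFun]
  rw [this, h]
  push_cast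
  congr 1
  · rw [neg_neg, div_one, Real.sqrt_eq_rpow, Complex.ofReal_cpow Real.pi_pos.le]
    norm_num
  · congr 1
    rw [mul_pow, mul_pow, Complex.I_sq]; ring

open Polynomial in
theorem wigner_scaled (x p : ℝ) (k : ℕ) :
    ∫ s : ℝ, ((hermiteH k (x - s) * hermiteH k (x + s) : ℝ) : ℂ) *
        Complex.exp (-(s:ℂ)^2 + 2 * (p * Complex.I) * s) =
      ((Real.sqrt Real.pi * Real.exp (-p^2) : ℝ) : ℂ) * ((2:ℂ)^k * (k.factorial : ℂ) *
        (((-1:ℝ)^k * laguerreL 0 k (2*(p^2+x^2)) : ℝ) : ℂ)) := by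
  rw [← alg_lag, ← gaussFun_one, ← alg_rec _ _ _ (gaussFun_parts p)]
  simp [gaussFun, hermiteH_eq]

theorem psi_prod (hbar : ℝ) (hh : 0 < hbar) (k : ℕ) (x y : ℝ) :
    psiH hbar k (x - hbar*y/2) * psiH hbar k (x + hbar*y/2) =
      (Real.sqrt Real.pi * 2^k * (Nat.factorial k) * Real.sqrt hbar)⁻¹ *
      Real.exp (-(x / Real.sqrt hbar)^2) *
      (hermiteH k (x / Real.sqrt hbar - Real.sqrt hbar / 2 * y) *
        hermiteH k (x / Real.sqrt hbar + Real.sqrt hbar / 2 * y) *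
        Real.exp (-(Real.sqrt hbar / 2 * y)^2)) := by
  have hs : 0 < Real.sqrt hbar := Real.sqrt_pos.2 hh
  have hsq : Real.sqrt hbar ^ 2 = hbar := Real.sq_sqrt hh.le
  have e1 : (x - hbar*y/2) / Real.sqrt hbar = x / Real.sqrt hbar - Real.sqrt hbar / 2 * y := by
    field_simp; rw [hsq]; ring
  have e2 : (x + hbar*y/2) / Real.sqrt hbar = x / Real.sqrt hbar + Real.sqrt hbar / 2 * y := by
    field_simp; rw [hsq]; ring
  have e3 : Real.exp (-(x - hbar*y/2)^2 / (2*hbar)) * Real.exp (-(x + hbar*y/2)^2 / (2*hbar)) =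
      Real.exp (-(x / Real.sqrt hbar)^2) * Real.exp (-(Real.sqrt hbar / 2 * y)^2) := by
    rw [← Real.exp_add, ← Real.exp_add, div_pow, mul_pow, div_pow, hsq]
    congr 1
    field_simp
    ring
  have hp : 0 ≤ Real.sqrt Real.pi * 2^k * (Nat.factorial k) * Real.sqrt hbar := by positivity
  have e4 := Real.mul_self_sqrt hp
  unfold psiH
  rw [e1, e2]
  set A := Real.sqrt (Real.sqrt Real.pi * 2^k * (Nat.factorial k) * Real.sqrt hbar)
  rw [← e4, mul_inv]
  linear_combination (A⁻¹ * A⁻¹ * hermiteH k (x / Real.sqrt hbar - Real.sqrt hbar / 2 * y) *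
        hermiteH k (x / Real.sqrt hbar + Real.sqrt hbar / 2 * y)) * e3

theorem herm_integrable (x p : ℝ) (k : ℕ) :
    Integrable (fun s : ℝ => ((hermiteH k (x - s) * hermiteH k (x + s) : ℝ) : ℂ) *
        Complex.exp (-(s:ℂ)^2 + 2 * (p * Complex.I) * s)) := by
  have := poly_gauss_integrable p ((hermPoly k).comp (Polynomial.C (x:ℂ) - Polynomial.X) *
    (hermPoly k).comp (Polynomial.C (x:ℂ) + Polynomial.X))
  simpa [hermiteH_eq] using this

theorem integrand_eq (hbar : ℝ) (hh : 0 < hbar) (k : ℕ) (x p y : ℝ) :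
    ((hbar * (psiH hbar k (x - hbar*y/2) * psiH hbar k (x + hbar*y/2)) : ℝ) : ℂ) *
      Complex.exp (Complex.I * (p:ℂ) * (y:ℂ)) =
    ((hbar * (Real.sqrt Real.pi * 2^k * (Nat.factorial k) * Real.sqrt hbar)⁻¹ *
      Real.exp (-(x / Real.sqrt hbar)^2) : ℝ) : ℂ) *
    (fun s : ℝ => ((hermiteH k (x / Real.sqrt hbar - s) *
        hermiteH k (x / Real.sqrt hbar + s) : ℝ) : ℂ) *
        Complex.exp (-(s:ℂ)^2 + 2 * (((p / Real.sqrt hbar : ℝ) : ℂ) * Complex.I) * s))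
      (Real.sqrt hbar / 2 * y) := by
  have hs : (Real.sqrt hbar : ℂ) ≠ 0 := by exact_mod_cast (Real.sqrt_pos.2 hh).ne'
  beta_reduce
  rw [psi_prod hbar hh, Complex.exp_add]
  have : 2 * (((p / Real.sqrt hbar : ℝ) : ℂ) * Complex.I) * ((Real.sqrt hbar / 2 * y : ℝ) : ℂ) =
      Complex.I * p * y := by
    push_cast; field_simp
  simp only [this]
  push_cast
  ring

/-- Laguerre-polynomial representation of the Weyl symbol of `P_{<N}`:
`σ_{P_{<N}}^ℏ(x,p) = 2 e^{-(p²+x²)/ℏ} Σ_{j=0}^{N-1} (-1)^j L_j(2(p²+x²)/ℏ)`. -/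
theorem sigmaP_laguerre (hbar : ℝ) (hh : 0 < hbar) (N : ℕ) (hN : 1 ≤ N) (x p : ℝ) :
    sigmaP hbar N x p =
      ((2 * Real.exp (-(p^2+x^2)/hbar) *
        ∑ j ∈ Finset.range N, (-1:ℝ)^j * laguerreL 0 j (2*(p^2+x^2)/hbar) : ℝ) : ℂ) := by
  have hs : 0 < Real.sqrt hbar := Real.sqrt_pos.2 hh
  have hsq : Real.sqrt hbar ^ 2 = hbar := Real.sq_sqrt hh.le
  have hc : Real.sqrt hbar / 2 ≠ 0 := by positivity
  unfold sigmaP KerK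
  simp only [Finset.mul_sum, Complex.ofReal_sum, Finset.sum_mul]
  rw [integral_finsetSum]
  · refine Finset.sum_congr rfl fun k _ => ?_
    simp only [integrand_eq hbar hh]
    have hcv := Measure.integral_comp_mul_left
      (fun s : ℝ => ((hermiteH k (x / Real.sqrt hbar - s) *
        hermiteH k (x / Real.sqrt hbar + s) : ℝ) : ℂ) *
        Complex.exp (-(s:ℂ)^2 + 2 * (((p / Real.sqrt hbar : ℝ) : ℂ) * Complex.I) * s))
      (Real.sqrt hbar / 2)
    beta_reduce at hcv
    rw [integral_const_mul, hcv, wigner_scaled]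
    have e1 : 2 * ((p / Real.sqrt hbar)^2 + (x / Real.sqrt hbar)^2) = 2 * (p^2+x^2)/hbar := by
      rw [div_pow, div_pow, hsq]; ring
    have e2 : Real.exp (-(p^2+x^2)/hbar) =
        Real.exp (-(p / Real.sqrt hbar)^2) * Real.exp (-(x / Real.sqrt hbar)^2) := by
      rw [← Real.exp_add, div_pow, div_pow, hsq]; congr 1; ring
    rw [e1, e2, abs_of_pos (by positivity), Complex.real_smul]
    norm_cast
    generalize laguerreL 0 k (2*(p^2+x^2)/hbar) = L
    generalize Real.exp (-(p / Real.sqrt hbar)^2) = E1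
    generalize Real.exp (-(x / Real.sqrt hbar)^2) = E2
    have hpi : 0 < Real.sqrt Real.pi := Real.sqrt_pos.2 Real.pi_pos
    have hk : (0:ℝ) < k.factorial := by exact_mod_cast Nat.factorial_pos k
    push_cast
    field_simp
    rw [hsq]
  · intro k _
    simp only [integrand_eq hbar hh]
    exact ((herm_integrable _ _ k).comp_mul_left' hc).const_mul _
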